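/- Let n ≥ 1, let A be an n×n real matrix, B ∈ ℝⁿ, and T > 0. Let (z¹,v¹),…,(z^{n+1},v^{n+1}) be solutions of ż = Az + Bv on [0,T] with each vⁱ continuous, and suppose Z(0) is invertible. Fix p ∈ ℕ and x₀ ∈ ℝⁿ, set ζ = Z(0)⁻¹ x₀, and suppose z : [pT,(p+1)T] → ℝⁿ is differentiable with z(pT) = x₀ and z′(t) = A z(t) + (V(t − pT) ζ) • B for all t ∈ [pT,(p+1)T]. Then z(t) = Z(t − pT) ζ for all t ∈ [pT,(p+1)T]; in particular z((p+1)T) = Z(T) Z(0)⁻¹ z(pT). -/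

import Mathlib

/-- The action of an `n × n` real matrix on `ℝⁿ` with the Euclidean norm. -/
noncomputable def matVec {n : ℕ} (M : Matrix (Fin n) (Fin n) ℝ)
    (x : EuclideanSpace ℝ (Fin n)) : EuclideanSpace ℝ (Fin n) :=
  Matrix.toEuclideanLin M x

/-- Given `n+1` points `w 0, …, w n` in `ℝⁿ`, the `n × n` matrix whose `i`-th column is
`w (i+1) - w 0`. -/
noncomputable def colDiffMat {n : ℕ} (w : Fin (n + 1) → EuclideanSpace ℝ (Fin n)) :
    Matrix (Fin n) (Fin n) ℝ :=
  Matrix.of fun r i => (w i.succ - w 0) r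

/-- Applying the difference matrix to `x` is the linear combination of the differences with
coefficients `x`. -/
lemma matVec_colDiffMat {n : ℕ} (w : Fin (n + 1) → EuclideanSpace ℝ (Fin n))
    (x : EuclideanSpace ℝ (Fin n)) :
    matVec (colDiffMat w) x = ∑ j, x j • (w j.succ - w 0) := by
  ext r
  simp [matVec, colDiffMat, Matrix.toLpLin_apply, Matrix.mulVec, dotProduct, mul_comm]

lemma matVec_mul {n : ℕ} (M N : Matrix (Fin n) (Fin n) ℝ) (x : EuclideanSpace ℝ (Fin n)) :
    matVec (M * N) x = matVec M (matVec N x) := by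
  simp [matVec, Matrix.toLpLin_apply, Matrix.mulVec_mulVec]

lemma matVec_one {n : ℕ} (x : EuclideanSpace ℝ (Fin n)) : matVec 1 x = x := by
  simp [matVec]

/-- Linear combinations of differences of solutions of `ż = Az + Bv` are solutions, for the
corresponding linear combination of differences of inputs. -/
lemma hasDerivAt_matVec_colDiffMat {n : ℕ} (A : Matrix (Fin n) (Fin n) ℝ)
    (B : EuclideanSpace ℝ (Fin n)) (z : Fin (n + 1) → ℝ → EuclideanSpace ℝ (Fin n))
    (v : Fin (n + 1) → ℝ → ℝ) (t : ℝ)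
    (hsol : ∀ i, HasDerivAt (z i) (matVec A (z i t) + v i t • B) t)
    (x : EuclideanSpace ℝ (Fin n)) :
    HasDerivAt (fun s => matVec (colDiffMat (fun i => z i s)) x)
      (matVec A (matVec (colDiffMat (fun i => z i t)) x) +
        (∑ j, (v j.succ t - v 0 t) * x j) • B) t := by
  simp only [matVec_colDiffMat]
  refine (HasDerivAt.fun_sum fun j _ =>
    ((hsol j.succ).fun_sub (hsol 0)).fun_const_smul (x j)).congr_deriv ?_
  simp only [matVec, map_sum, map_smul, map_sub, Finset.sum_smul, ← Finset.sum_add_distrib]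
  refine Finset.sum_congr rfl fun j _ => ?_
  module

/-- Two solutions on `[a, b]` of a linear system with the same input and the same initial value
coincide on `[a, b]`. -/
lemma eqOn_Icc_of_hasDerivWithinAt_matVec_add {n : ℕ} (A : Matrix (Fin n) (Fin n) ℝ)
    (u f g : ℝ → EuclideanSpace ℝ (Fin n)) (a b : ℝ)
    (hf : ∀ t ∈ Set.Icc a b, HasDerivWithinAt f (matVec A (f t) + u t) (Set.Icc a b) t)
    (hg : ∀ t ∈ Set.Icc a b, HasDerivWithinAt g (matVec A (g t) + u t) (Set.Icc a b) t)
    (ha : f a = g a) : Set.EqOn f g (Set.Icc a b) := by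
  let L := LinearMap.toContinuousLinearMap (Matrix.toEuclideanLin A)
  refine ODE_solution_unique (v := fun t y => matVec A y + u t) (K := ‖L‖₊)
    (fun t => ?_) (fun t ht => (hf t ht).continuousWithinAt) (fun t ht => ?_)
    (fun t ht => (hg t ht).continuousWithinAt) (fun t ht => ?_) ha
  · refine LipschitzWith.of_dist_le_mul fun x y => ?_
    rw [dist_add_right]
    exact L.lipschitz.dist_le_mul x y
  · exact (hf t (Set.Ico_subset_Icc_self ht)).mono_of_mem_nhdsWithin (Icc_mem_nhdsGE_of_mem ht)
  · exact (hg t (Set.Ico_subset_Icc_self ht)).mono_of_mem_nhdsWithin (Icc_mem_nhdsGE_of_mem ht)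

/-- under the learned open-loop controller `v(t) = V(t − pT) ζ` with
`ζ = Z(0)⁻¹ x₀`, the closed-loop trajectory starting from `z(pT) = x₀` coincides with the
affine combination `Z(t − pT) ζ` of the demonstrations on `[pT,(p+1)T]`; in particular
`z((p+1)T) = Z(T) Z(0)⁻¹ z(pT)`. -/
theorem closed_loop_equals_affine_combination
    (n : ℕ) (hn : 1 ≤ n)
    (A : Matrix (Fin n) (Fin n) ℝ) (B : EuclideanSpace ℝ (Fin n))
    (T : ℝ) (hT : 0 < T)
    (z : Fin (n + 1) → ℝ → EuclideanSpace ℝ (Fin n)) (v : Fin (n + 1) → ℝ → ℝ)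
    (hsol : ∀ i, ∀ t ∈ Set.Icc (0 : ℝ) T,
      HasDerivAt (z i) (matVec A (z i t) + v i t • B) t)
    (hv : ∀ i, ContinuousOn (v i) (Set.Icc (0 : ℝ) T))
    (hZ0 : IsUnit (colDiffMat (fun i => z i 0)))
    (p : ℕ) (x₀ : EuclideanSpace ℝ (Fin n))
    (ζ : EuclideanSpace ℝ (Fin n))
    (hζ : ζ = matVec (colDiffMat (fun i => z i 0))⁻¹ x₀)
    (w : ℝ → EuclideanSpace ℝ (Fin n))
    (hw0 : w ((p : ℝ) * T) = x₀)
    (hw : ∀ t ∈ Set.Icc ((p : ℝ) * T) (((p : ℝ) + 1) * T),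
      HasDerivWithinAt w
        (matVec A (w t) +
          (∑ j, (v j.succ (t - (p : ℝ) * T) - v 0 (t - (p : ℝ) * T)) * ζ j) • B)
        (Set.Icc ((p : ℝ) * T) (((p : ℝ) + 1) * T)) t) :
    (∀ t ∈ Set.Icc ((p : ℝ) * T) (((p : ℝ) + 1) * T),
      w t = matVec (colDiffMat (fun i => z i (t - (p : ℝ) * T))) ζ) ∧
      w (((p : ℝ) + 1) * T) =
        matVec ((colDiffMat (fun i => z i T)) * (colDiffMat (fun i => z i 0))⁻¹)
          (w ((p : ℝ) * T)) := by
  have key : ∀ t ∈ Set.Icc ((p : ℝ) * T) (((p : ℝ) + 1) * T),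
      w t = matVec (colDiffMat (fun i => z i (t - (p : ℝ) * T))) ζ := by
    refine eqOn_Icc_of_hasDerivWithinAt_matVec_add A
      (fun t => (∑ j, (v j.succ (t - (p : ℝ) * T) - v 0 (t - (p : ℝ) * T)) * ζ j) • B)
      w _ _ _ hw (fun t ht => ?_) ?_
    · have ht' : t - (p : ℝ) * T ∈ Set.Icc (0 : ℝ) T :=
        ⟨by linarith [ht.1], by linarith [ht.2]⟩
      exact ((hasDerivAt_matVec_colDiffMat A B z v _ (fun i => hsol i _ ht') ζ).comp_sub_const
        t ((p : ℝ) * T)).hasDerivWithinAt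
    · simp only [sub_self]
      rw [hw0, hζ, ← matVec_mul,
        Matrix.mul_nonsing_inv _ ((Matrix.isUnit_iff_isUnit_det _).1 hZ0), matVec_one]
  refine ⟨key, ?_⟩
  rw [key _ ⟨by linarith, le_rfl⟩, matVec_mul, hw0, ← hζ,
    show ((p : ℝ) + 1) * T - (p : ℝ) * T = T by ring]
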